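/- Let ℙ_X and ℙ_Y be probability measures on measurable spaces 𝒳 and 𝒴, let ψ_{X,1},…,ψ_{X,m_X} : 𝒳 → ℝ be integrable functions that are linearly independent in L²(ℙ_X), let ψ_{Y,1},…,ψ_{Y,m_Y} : 𝒴 → ℝ be integrable functions that are linearly independent in L²(ℙ_Y), let H ∈ ℝ^{m_Y × m_X}, and let p : 𝒳 × 𝒴 → ℝ satisfy ∫_𝒴 p(x,y) dℙ_Y(y) = 1 for ℙ_X-a.e. x and ∫_𝒳 p(x,y) dℙ_X(x) = 1 for ℙ_Y-a.e. y. If g(x,y) := p(x,y) + Σ_{i,j} H_{j,i} ψ_{X,i}(x) ψ_{Y,j}(y) satisfies ∫_𝒴 g(x,y) dℙ_Y(y) = 1 for ℙ_X-a.e. x and ∫_𝒳 g(x,y) dℙ_X(x) = 1 for ℙ_Y-a.e. y, then Σ_{j=1}^{m_Y} (∫_𝒴 ψ_{Y,j} dℙ_Y) H_{j,i} = 0 for every i and Σ_{i=1}^{m_X} H_{j,i} (∫_𝒳 ψ_{X,i} dℙ_X) = 0 for every j. -/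

import Mathlib

open MeasureTheory

/-- If `p` and `p + Σ_{i,j} A_{j,i} φ_i ⊗ χ_j` both integrate to one over the second variable and
the `φ_i` are linearly independent modulo null functions, then the vector of integrals of the `χ_j`
annihilates `A`. -/
theorem sum_integral_mul_eq_zero_of_integral_eq_one
    {S T ι κ : Type*} [MeasurableSpace S] [MeasurableSpace T] [Fintype ι] [Fintype κ]
    {μ : Measure S} {ν : Measure T} {φ : ι → S → ℝ} {χ : κ → T → ℝ}
    (hχ : ∀ j, Integrable (χ j) ν)
    (hφ : ∀ c : ι → ℝ, (∀ᵐ s ∂μ, ∑ i, c i * φ i s = 0) → c = 0)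
    (A : Matrix κ ι ℝ) {p : S → T → ℝ}
    (hp : ∀ᵐ s ∂μ, ∫ t, p s t ∂ν = 1)
    (hg : ∀ᵐ s ∂μ, ∫ t, (p s t + ∑ i, ∑ j, A j i * φ i s * χ j t) ∂ν = 1) (i : ι) :
    ∑ j, (∫ t, χ j t ∂ν) * A j i = 0 := by
  refine congrFun (hφ (fun i => ∑ j, (∫ t, χ j t ∂ν) * A j i) ?_) i
  filter_upwards [hp, hg] with s hps hgs
  have hpint : Integrable (p s) ν := .of_integral_ne_zero (by simp [hps])
  have hterm : ∀ i j, Integrable (fun t => A j i * φ i s * χ j t) ν :=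
    fun i j => (hχ j).const_mul _
  have hrow : ∀ i, Integrable (fun t => ∑ j, A j i * φ i s * χ j t) ν :=
    fun i => integrable_finsetSum _ fun j _ => hterm i j
  rw [integral_add hpint (integrable_finsetSum _ fun i _ => hrow i), hps, add_eq_left,
    integral_finsetSum _ fun i _ => hrow i] at hgs
  rw [← hgs]
  refine Finset.sum_congr rfl fun i _ => ?_
  rw [integral_finsetSum _ fun j _ => hterm i j, Finset.sum_mul]
  refine Finset.sum_congr rfl fun j _ => ?_
  rw [integral_const_mul]
  ring

/-- Lemma 4.1 (Normalization, necessity): if the basis functions are linearly independent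
in `L²`, then the normalization of `g = p + Σ_{i,j} H_{j,i} ψ_{X,i} ⊗ ψ_{Y,j}` forces
the matrix conditions `(I_X ψ_Y) H = 0` and `H (I_Y ψ_X)ᵀ = 0`. -/
theorem stmt12
    {X Y : Type*} [MeasurableSpace X] [MeasurableSpace Y]
    (PX : Measure X) (PY : Measure Y)
    [IsProbabilityMeasure PX] [IsProbabilityMeasure PY]
    {mX mY : ℕ}
    (ψX : Fin mX → X → ℝ) (hψXm : ∀ i, Measurable (ψX i))
    (hψXint : ∀ i, Integrable (ψX i) PX)
    (hψXli : ∀ c : Fin mX → ℝ, (∀ᵐ x ∂PX, ∑ i, c i * ψX i x = 0) → c = 0)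
    (ψY : Fin mY → Y → ℝ) (hψYm : ∀ j, Measurable (ψY j))
    (hψYint : ∀ j, Integrable (ψY j) PY)
    (hψYli : ∀ c : Fin mY → ℝ, (∀ᵐ y ∂PY, ∑ j, c j * ψY j y = 0) → c = 0)
    (Hm : Matrix (Fin mY) (Fin mX) ℝ)
    (p : X × Y → ℝ)
    (hpX : ∀ᵐ x ∂PX, ∫ y, p (x, y) ∂PY = 1)
    (hpY : ∀ᵐ y ∂PY, ∫ x, p (x, y) ∂PX = 1)
    (g : X × Y → ℝ)
    (hg : ∀ x y, g (x, y) = p (x, y) + ∑ i, ∑ j, Hm j i * ψX i x * ψY j y)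
    (hgX : ∀ᵐ x ∂PX, ∫ y, g (x, y) ∂PY = 1)
    (hgY : ∀ᵐ y ∂PY, ∫ x, g (x, y) ∂PX = 1) :
    (∀ i, ∑ j, (∫ y, ψY j y ∂PY) * Hm j i = 0) ∧
    (∀ j, ∑ i, Hm j i * (∫ x, ψX i x ∂PX) = 0) := by
  simp only [hg] at hgX hgY
  refine ⟨sum_integral_mul_eq_zero_of_integral_eq_one hψYint hψXli Hm hpX hgX, fun j => ?_⟩
  have hswap : ∀ᵐ y ∂PY, ∫ x, (p (x, y) + ∑ j, ∑ i, Hm.transpose i j * ψY j y * ψX i x) ∂PX = 1 := by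
    filter_upwards [hgY] with y hy
    rw [← hy]
    congr 1 with x
    rw [Finset.sum_comm]
    simp only [Matrix.transpose_apply, mul_right_comm]
  simpa only [Matrix.transpose_apply, mul_comm] using
    sum_integral_mul_eq_zero_of_integral_eq_one hψXint hψYli Hm.transpose hpY hswap j
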